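/- Let k be an infinite field of characteristic different from 2. Let (P₁, P₂) and (Q₁, Q₂) be two pairs of 3×4 matrices over k, each matrix of rank 3, with the kernels of P₁ and P₂ distinct and the kernels of Q₁ and Q₂ distinct. Suppose there is a nonzero 3×3 matrix A over k such that (P₁ *ᵥ ξ) ⬝ᵥ (A *ᵥ (P₂ *ᵥ ξ)) = 0 and (Q₁ *ᵥ ξ) ⬝ᵥ (A *ᵥ (Q₂ *ᵥ ξ)) = 0 for every ξ ∈ k⁴. Then there exist an invertible 4×4 matrix H over k and nonzero scalars λ₁, λ₂ ∈ k such that Q₁ = λ₁ • (P₁ * H) and Q₂ = λ₂ • (P₂ * H). -/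

import Mathlib

open Matrix

namespace CameraPair

variable {k : Type*} [Field k]

theorem mulVec_surjective_of_rank_eq {m n : ℕ} {P : Matrix (Fin m) (Fin n) k}
    (hP : P.rank = m) : Function.Surjective P.mulVec := by
  have h : LinearMap.range P.mulVecLin = ⊤ := by
    apply Submodule.eq_top_of_finrank_eq
    rw [Module.finrank_fin_fun]
    exact hP
  exact LinearMap.range_eq_top.mp h

theorem exists_right_inverse_of_rank_eq {m n : ℕ} {P : Matrix (Fin m) (Fin n) k}
    (hP : P.rank = m) : ∃ R : Matrix (Fin n) (Fin m) k, P * R = 1 :=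
  mulVec_surjective_iff_exists_right_inverse.mp (mulVec_surjective_of_rank_eq hP)

theorem finrank_ker_of_rank_eq {P : Matrix (Fin 3) (Fin 4) k} (hP : P.rank = 3) :
    Module.finrank k (LinearMap.ker P.mulVecLin) = 1 := by
  have h := LinearMap.finrank_range_add_finrank_ker P.mulVecLin
  rw [Module.finrank_fin_fun] at h
  change P.rank + _ = 4 at h
  omega

theorem eq_zero_of_mem_ker_of_mem_ker {P₁ P₂ : Matrix (Fin 3) (Fin 4) k}
    (hP₁ : P₁.rank = 3) (hP₂ : P₂.rank = 3)
    (hker : LinearMap.ker P₁.mulVecLin ≠ LinearMap.ker P₂.mulVecLin)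
    {x : Fin 4 → k} (h₁ : P₁ *ᵥ x = 0) (h₂ : P₂ *ᵥ x = 0) : x = 0 := by
  by_contra hx
  have span_eq : ∀ {P : Matrix (Fin 3) (Fin 4) k}, P.rank = 3 → P *ᵥ x = 0 →
      k ∙ x = LinearMap.ker P.mulVecLin := by
    intro P hP h
    apply Submodule.eq_of_le_of_finrank_eq
    · rw [Submodule.span_singleton_le_iff_mem]
      exact h
    · rw [finrank_span_singleton hx, finrank_ker_of_rank_eq hP]
  exact hker ((span_eq hP₁ h₁).symm.trans (span_eq hP₂ h₂))

theorem exists_crossProduct_eq_of_alternating {S : Matrix (Fin 3) (Fin 3) k}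
    (hS : ∀ x, x ⬝ᵥ (S *ᵥ x) = 0) : ∃ s, ∀ x, S *ᵥ x = crossProduct s x := by
  have h0 := hS ![1, 0, 0]
  have h1 := hS ![0, 1, 0]
  have h2 := hS ![0, 0, 1]
  have h01 := hS ![1, 1, 0]
  have h02 := hS ![1, 0, 1]
  have h12 := hS ![0, 1, 1]
  simp [dotProduct, mulVec, Fin.sum_univ_three] at h0 h1 h2 h01 h02 h12
  refine ⟨![S 2 1, S 0 2, S 1 0], fun x => ?_⟩
  ext i
  fin_cases i <;> simp [cross_apply, dotProduct, mulVec, Fin.sum_univ_three] <;> grind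

theorem exists_eq_smul_of_crossProduct_eq_zero {s x : Fin 3 → k} (hs : s ≠ 0)
    (h : crossProduct s x = 0) : ∃ c : k, x = c • s := by
  by_contra! hc
  refine crossProduct_ne_zero_iff_linearIndependent.mpr ?_ h
  rw [LinearIndependent.pair_iff' hs]
  exact fun a ha => hc a ha.symm

/-- A nonzero bilinear form vanishing on the joint image of `(P₁, P₂)` is, up to `P₁` and `P₂`,
a nonzero cross product. -/
theorem exists_crossProduct_eq {P₁ P₂ : Matrix (Fin 3) (Fin 4) k}
    (hP₁ : P₁.rank = 3) (hP₂ : P₂.rank = 3)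
    {A : Matrix (Fin 3) (Fin 3) k} (hA : A ≠ 0)
    (hvan : ∀ ξ : Fin 4 → k, (P₁ *ᵥ ξ) ⬝ᵥ (A *ᵥ (P₂ *ᵥ ξ)) = 0) :
    ∃ s : Fin 3 → k, s ≠ 0 ∧ ∀ ξ, A *ᵥ (P₂ *ᵥ ξ) = crossProduct s (P₁ *ᵥ ξ) := by
  have hpol : ∀ ξ ζ, (P₁ *ᵥ ζ) ⬝ᵥ (A *ᵥ (P₂ *ᵥ ξ)) = -((P₁ *ᵥ ξ) ⬝ᵥ (A *ᵥ (P₂ *ᵥ ζ))) := by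
    intro ξ ζ
    have h := hvan (ξ + ζ)
    simp only [mulVec_add, add_dotProduct, dotProduct_add, hvan] at h
    linear_combination h
  have hzero : ∀ ξ, P₁ *ᵥ ξ = 0 → A *ᵥ (P₂ *ᵥ ξ) = 0 := by
    intro ξ hξ
    apply dotProduct_eq_zero
    intro y
    obtain ⟨ζ, rfl⟩ := mulVec_surjective_of_rank_eq hP₁ y
    rw [dotProduct_comm, hpol, hξ, zero_dotProduct, neg_zero]
  obtain ⟨R, hR⟩ := exists_right_inverse_of_rank_eq hP₁
  have hR' : ∀ x, P₁ *ᵥ (R *ᵥ x) = x := fun x => by rw [mulVec_mulVec, hR, one_mulVec]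
  obtain ⟨s, hs⟩ := exists_crossProduct_eq_of_alternating (S := A * P₂ * R) fun x => by
    rw [← mulVec_mulVec, ← mulVec_mulVec]
    nth_rewrite 1 [← hR' x]
    exact hvan _
  have hcross : ∀ ξ, A *ᵥ (P₂ *ᵥ ξ) = crossProduct s (P₁ *ᵥ ξ) := by
    intro ξ
    rw [← hs, ← mulVec_mulVec, ← mulVec_mulVec, ← sub_eq_zero, ← mulVec_sub, ← mulVec_sub]
    apply hzero
    rw [mulVec_sub, hR', sub_self]
  refine ⟨s, ?_, hcross⟩
  rintro rfl
  apply hA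
  apply ext_of_mulVec_single
  intro i
  obtain ⟨ξ, hξ⟩ := mulVec_surjective_of_rank_eq hP₂ (Pi.single i 1)
  simp only [← hξ, hcross, map_zero, LinearMap.zero_apply, zero_mulVec]

theorem exists_smul_eq {P₁ P₂ Q₁ Q₂ : Matrix (Fin 3) (Fin 4) k}
    (hP₁ : P₁.rank = 3) (hQ₂ : Q₂.rank = 3) {A : Matrix (Fin 3) (Fin 3) k}
    {s t : Fin 3 → k} (hs : s ≠ 0) (ht : t ≠ 0)
    (hsP : ∀ ξ, A *ᵥ (P₂ *ᵥ ξ) = crossProduct s (P₁ *ᵥ ξ))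
    (htQ : ∀ ξ, A *ᵥ (Q₂ *ᵥ ξ) = crossProduct t (Q₁ *ᵥ ξ)) :
    ∃ c : k, c ≠ 0 ∧ t = c • s := by
  have htA : ∀ y, t ⬝ᵥ (A *ᵥ y) = 0 := by
    intro y
    obtain ⟨ξ, rfl⟩ := mulVec_surjective_of_rank_eq hQ₂ y
    exact (congrArg (t ⬝ᵥ ·) (htQ ξ)).trans (dot_self_cross _ _)
  have hst : crossProduct s t = 0 := by
    apply dotProduct_eq_zero
    intro x
    obtain ⟨ξ, rfl⟩ := mulVec_surjective_of_rank_eq hP₁ x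
    have h := htA (P₂ *ᵥ ξ)
    rw [hsP, ← triple_product_permutation] at h
    rw [dotProduct_comm, ← cross_anticomm, dotProduct_neg, neg_eq_zero]
    exact h
  obtain ⟨c, rfl⟩ := exists_eq_smul_of_crossProduct_eq_zero hs hst
  exact ⟨c, fun hc => ht (by rw [hc, zero_smul]), rfl⟩

theorem exists_mulVec_eq_of_mulVec_eq_zero {Q₁ Q₂ : Matrix (Fin 3) (Fin 4) k}
    (hQ₁ : Q₁.rank = 3) (hQ₂ : Q₂.rank = 3)
    (hker : LinearMap.ker Q₁.mulVecLin ≠ LinearMap.ker Q₂.mulVecLin)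
    {A : Matrix (Fin 3) (Fin 3) k} {t : Fin 3 → k} (ht : t ≠ 0)
    (htQ : ∀ ξ, A *ᵥ (Q₂ *ᵥ ξ) = crossProduct t (Q₁ *ᵥ ξ))
    {y : Fin 3 → k} (hy : A *ᵥ y = 0) : ∃ δ, Q₁ *ᵥ δ = 0 ∧ Q₂ *ᵥ δ = y := by
  have hbot : LinearMap.ker Q₂.mulVecLin ≠ ⊥ := by
    intro h
    have h1 := finrank_ker_of_rank_eq hQ₂
    rw [h, finrank_bot] at h1
    exact zero_ne_one h1
  obtain ⟨d, hd, hd0⟩ := Submodule.exists_mem_ne_zero_of_ne_bot hbot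
  replace hd : Q₂ *ᵥ d = 0 := hd
  have hQd : Q₁ *ᵥ d ≠ 0 := fun h => hd0 (eq_zero_of_mem_ker_of_mem_ker hQ₁ hQ₂ hker h hd)
  obtain ⟨a, ha⟩ := exists_eq_smul_of_crossProduct_eq_zero ht
    (x := Q₁ *ᵥ d) (by rw [← htQ, hd, mulVec_zero])
  have ha0 : a ≠ 0 := by
    rintro rfl
    exact hQd (by rw [ha, zero_smul])
  obtain ⟨η, rfl⟩ := mulVec_surjective_of_rank_eq hQ₂ y
  obtain ⟨b, hb⟩ := exists_eq_smul_of_crossProduct_eq_zero ht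
    (x := Q₁ *ᵥ η) (by rw [← htQ]; exact hy)
  refine ⟨η - (b / a) • d, ?_, ?_⟩
  · rw [mulVec_sub, mulVec_smul, hb, ha, smul_smul, div_mul_cancel₀ _ ha0, sub_self]
  · rw [mulVec_sub, mulVec_smul, hd, smul_zero, sub_zero]

end CameraPair

/-- Two camera pairs with a common fundamental matrix are projectively
equivalent: they differ by an invertible 4×4 matrix and scalings. -/
theorem common_fundamental_matrix_projective_equivalence
    {k : Type*} [Field k] [Infinite k] (hchar : (2 : k) ≠ 0)
    (P₁ P₂ Q₁ Q₂ : Matrix (Fin 3) (Fin 4) k)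
    (hP₁ : P₁.rank = 3) (hP₂ : P₂.rank = 3)
    (hQ₁ : Q₁.rank = 3) (hQ₂ : Q₂.rank = 3)
    (hPker : LinearMap.ker P₁.mulVecLin ≠ LinearMap.ker P₂.mulVecLin)
    (hQker : LinearMap.ker Q₁.mulVecLin ≠ LinearMap.ker Q₂.mulVecLin)
    (A : Matrix (Fin 3) (Fin 3) k) (hA : A ≠ 0)
    (hvanP : ∀ ξ : Fin 4 → k, (P₁ *ᵥ ξ) ⬝ᵥ (A *ᵥ (P₂ *ᵥ ξ)) = 0)
    (hvanQ : ∀ ξ : Fin 4 → k, (Q₁ *ᵥ ξ) ⬝ᵥ (A *ᵥ (Q₂ *ᵥ ξ)) = 0) :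
    ∃ (H : Matrix (Fin 4) (Fin 4) k) (lam₁ lam₂ : k),
      IsUnit H ∧ lam₁ ≠ 0 ∧ lam₂ ≠ 0 ∧
      Q₁ = lam₁ • (P₁ * H) ∧ Q₂ = lam₂ • (P₂ * H) := by
  obtain ⟨s, hs, hsP⟩ := CameraPair.exists_crossProduct_eq hP₁ hP₂ hA hvanP
  obtain ⟨t, ht, htQ⟩ := CameraPair.exists_crossProduct_eq hQ₁ hQ₂ hA hvanQ
  obtain ⟨c, hc, rfl⟩ := CameraPair.exists_smul_eq hP₁ hQ₂ hs ht hsP htQ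
  have hlift : ∀ ξ, ∃ η, Q₁ *ᵥ η = P₁ *ᵥ ξ ∧ Q₂ *ᵥ η = c • (P₂ *ᵥ ξ) := by
    intro ξ
    obtain ⟨η, hη⟩ := CameraPair.mulVec_surjective_of_rank_eq hQ₁ (P₁ *ᵥ ξ)
    have hy : A *ᵥ (c • (P₂ *ᵥ ξ) - Q₂ *ᵥ η) = 0 := by
      rw [mulVec_sub, mulVec_smul, hsP, htQ, hη, map_smul, LinearMap.smul_apply, sub_self]
    obtain ⟨δ, hδ₁, hδ₂⟩ :=
      CameraPair.exists_mulVec_eq_of_mulVec_eq_zero hQ₁ hQ₂ hQker ht htQ hy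
    refine ⟨η + δ, ?_, ?_⟩
    · rw [mulVec_add, hη, hδ₁, add_zero]
    · rw [mulVec_add, hδ₂, add_sub_cancel]
  choose η hη₁ hη₂ using fun j : Fin 4 => hlift (Pi.single j 1)
  set G : Matrix (Fin 4) (Fin 4) k := (Matrix.of η)ᵀ with hG
  have hcol : ∀ j, G *ᵥ Pi.single j 1 = η j := fun j => by rw [mulVec_single_one]; rfl
  have hG₁ : Q₁ * G = P₁ := by
    apply ext_of_mulVec_single
    intro j
    rw [← mulVec_mulVec, hcol, hη₁]
  have hG₂ : Q₂ * G = c • P₂ := by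
    apply ext_of_mulVec_single
    intro j
    rw [← mulVec_mulVec, hcol, hη₂, smul_mulVec]
  have hunit : IsUnit G := by
    rw [← mulVec_injective_iff_isUnit]
    refine (injective_iff_map_eq_zero G.mulVecLin).mpr fun x hx => ?_
    change G *ᵥ x = 0 at hx
    apply CameraPair.eq_zero_of_mem_ker_of_mem_ker hP₁ hP₂ hPker
    · rw [← hG₁, ← mulVec_mulVec, hx, mulVec_zero]
    · have h : c • (P₂ *ᵥ x) = 0 := by
        rw [← smul_mulVec, ← hG₂, ← mulVec_mulVec, hx, mulVec_zero]
      exact (smul_eq_zero.mp h).resolve_left hc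
  have hdet := (isUnit_iff_isUnit_det G).mp hunit
  refine ⟨G⁻¹, 1, c, (isUnit_nonsing_inv_iff).mpr hunit, one_ne_zero, hc, ?_, ?_⟩
  · rw [one_smul, ← hG₁, mul_nonsing_inv_cancel_right _ _ hdet]
  · rw [← smul_mul, ← hG₂, mul_nonsing_inv_cancel_right _ _ hdet]
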